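/- Let G = (𝒱, E) be a finite connected simple graph with a ZV-ordered partition ⟨Z, V_1, …, V_k⟩, and for i = 1,…,k let F_i be a mechanism on the induced subgraph G_i on V_i such that: F_i is anonymous and Pareto optimal; for infinitely many τ ∈ ℕ there exists a profile over V_i in which every location of V_i is voted for at least τ times and F_i returns R(V_i); and F_i is group-manipulation-resistant (as a mechanism on G_i). Suppose further that R(V_i) ∈ Z for all i = 1,…,k, and that the mechanism F_Z, defined on profiles over Z and returning the leftmost Pareto optimal location in Z, is group-manipulation-resistant. Then the mechanism F* is group-manipulation-resistant. -/

import Mathlib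

/- Common framework: finite connected simple graphs, shortest-path distance,
   profiles as lists of vertices, mechanisms as functions `List α → α`,
   anonymity, Pareto optimality, and group-manipulation-resistance. -/

open Classical

noncomputable section

/-- The ball of radius `r` around `v`. -/
def ball {α : Type} (G : SimpleGraph α) (v : α) (r : ℕ) : Set α :=
  {u | G.dist v u ≤ r}

/-- Distance from a vertex to a (nonempty) set of vertices. -/
def distToSet {α : Type} (G : SimpleGraph α) (v : α) (Z : Finset α) : ℕ :=
  sInf ((fun z => G.dist v z) '' (Z : Set α))

/-- An agent located at `ℓ` weakly prefers `a` over `b`. -/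
def wPref {α : Type} (G : SimpleGraph α) (ℓ a b : α) : Prop := G.dist ℓ a ≤ G.dist ℓ b

/-- An agent located at `ℓ` strictly prefers `a` over `b`. -/
def sPref {α : Type} (G : SimpleGraph α) (ℓ a b : α) : Prop := G.dist ℓ a < G.dist ℓ b

/-- `u` Pareto dominates `v` w.r.t. the profile `x`. -/
def Dominates {α : Type} (G : SimpleGraph α) (x : List α) (u v : α) : Prop :=
  (∀ a ∈ x, wPref G a u v) ∧ (∃ a ∈ x, sPref G a u v)

/-- The set of Pareto optimal locations for a profile `x`. -/
def PO {α : Type} (G : SimpleGraph α) (x : List α) : Set α :=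
  {v | ¬ ∃ u, Dominates G x u v}

/-- A mechanism is anonymous if its outcome is invariant under permutations of ballots. -/
def Anonymous {α : Type} (F : List α → α) : Prop :=
  ∀ x y : List α, x.Perm y → F x = F y

/-- A mechanism is Pareto optimal if its outcome is always Pareto optimal. -/
def ParetoOptimal {α : Type} (G : SimpleGraph α) (F : List α → α) : Prop :=
  ∀ x : List α, F x ∈ PO G x

/-- The list of ballots `x j` for agents `j` outside the coalition `C`. -/
def profileMinus {α : Type} {n : ℕ} (x : Fin n → α) (C : Finset (Fin n)) : List α :=
  ((List.finRange n).filter (fun i => decide (i ∉ C))).map x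

/-- Group-manipulation-resistance where all sincere ballots and all manipulated
ballots are required to lie in the set `S`. -/
def GMRon {α : Type} (G : SimpleGraph α) (S : Set α) (F : List α → α) : Prop :=
  ¬ ∃ (n : ℕ) (x : Fin n → α) (C : Finset (Fin n)) (A : List α),
      (∀ i, x i ∈ S) ∧ (∀ a ∈ A, a ∈ S) ∧
      (∀ i ∈ C, wPref G (x i) (F (A ++ profileMinus x C)) (F (List.ofFn x))) ∧
      (∃ i ∈ C, sPref G (x i) (F (A ++ profileMinus x C)) (F (List.ofFn x)))

/-- Group-manipulation-resistance: no coalition `C` can, by replacing its ballots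
with an arbitrary finite tuple `A` of ballots (misreporting, false-name voting,
or abstaining), obtain an outcome that all its members weakly prefer and at least
one member strictly prefers. -/
def GMR {α : Type} (G : SimpleGraph α) (F : List α → α) : Prop :=
  ¬ ∃ (n : ℕ) (x : Fin n → α) (C : Finset (Fin n)) (A : List α),
      (∀ i ∈ C, wPref G (x i) (F (A ++ profileMinus x C)) (F (List.ofFn x))) ∧
      (∃ i ∈ C, sPref G (x i) (F (A ++ profileMinus x C)) (F (List.ofFn x)))

/-- `A` is an interval in `Z` (w.r.t. the order injection `ord`): it is a subset
of `Z` that is order-convex within `Z`. -/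
def IsIntervalIn {α : Type} (ord : α → ℝ) (Z : Finset α) (A : Set α) : Prop :=
  A ⊆ (Z : Set α) ∧
  ∀ a ∈ A, ∀ b ∈ A, ∀ c ∈ Z, ord a ≤ ord c → ord c ≤ ord b → c ∈ A

/-- A ZV-ordered partition ⟨Z, V₁, …, V_k⟩ of a connected graph `G`, together with
the order (injection into ℝ) on `Z` and the roots of the `Vᵢ`. -/
structure ZVPartition {α : Type} (G : SimpleGraph α) where
  hconn : G.Connected
  k : ℕ
  Z : Finset α
  Vs : Fin k → Finset α
  ord : α → ℝ
  Z_nonempty : Z.Nonempty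
  Vs_nonempty : ∀ i, (Vs i).Nonempty
  ord_inj : Set.InjOn ord (Z : Set α)
  Vs_disjoint : ∀ i j, i ≠ j → Disjoint (Vs i) (Vs j)
  cover : ∀ v : α, v ∈ Z ∨ ∃ i, v ∈ Vs i
  no_drop_Z : ¬ ∀ v : α, ∃ i, v ∈ Vs i
  no_drop_Vs : ∀ i : Fin k, ¬ ∀ v : α, v ∈ Z ∨ ∃ j, j ≠ i ∧ v ∈ Vs j
  root : Fin k → α
  root_mem : ∀ i, root i ∈ Vs i
  root_min : ∀ i, ∀ u ∈ Vs i, distToSet G (root i) Z ≤ distToSet G u Z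
  root_unique : ∀ i, ∀ u ∈ Vs i, (∀ w ∈ Vs i, distToSet G u Z ≤ distToSet G w Z) → u = root i
  separation : ∀ i : Fin k, ∀ u ∈ Vs i, ∀ v : α, v ∉ Vs i →
      ∀ p : G.Walk u v, root i ∈ p.support ∧ ∃ z ∈ Z, z ∈ p.support

/-- `G` is a ZV-line graph w.r.t. the ZV-ordered partition `P`: balls of radius 1
around Z-vertices meet `Z` in intervals, each induced subgraph on `Vᵢ` is
recursively a ZV-line graph whose Z-set contains the root of `Vᵢ` as its leftmost
element, and balls of radius 1 around the roots meet `Z` in intervals. -/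
inductive IsZVLineGraph : {β : Type} → {H : SimpleGraph β} → ZVPartition H → Prop
  | mk {β : Type} {H : SimpleGraph β} (P : ZVPartition H)
      (hb : ∀ z ∈ P.Z, IsIntervalIn P.ord P.Z (ball H z 1 ∩ (P.Z : Set β)))
      (Q : ∀ i : Fin P.k, ZVPartition (H.induce ((P.Vs i : Finset β) : Set β)))
      (hQ : ∀ i, IsZVLineGraph (Q i))
      (hroot : ∀ i : Fin P.k, ∃ h : P.root i ∈ ((P.Vs i : Finset β) : Set β),
          (⟨P.root i, h⟩ : ((P.Vs i : Finset β) : Set β)) ∈ (Q i).Z ∧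
          ∀ z ∈ (Q i).Z, (Q i).ord ⟨P.root i, h⟩ ≤ (Q i).ord z)
      (hballroot : ∀ i, IsIntervalIn P.ord P.Z (ball H (P.root i) 1 ∩ (P.Z : Set β))) :
      IsZVLineGraph P

/-- `F` is the mechanism `F*` determined by the ZV-ordered partition `P` and the
mechanisms `Fi` on the induced subgraphs: if all (at least one) ballots belong
to a common `Vᵢ`, return `Fᵢ` applied to the ballots; otherwise return the
leftmost Pareto optimal location in `Z`. -/
def IsFStar {α : Type} (G : SimpleGraph α) (P : ZVPartition G)
    (Fi : ∀ i : Fin P.k, List ((P.Vs i : Finset α) : Set α) → ((P.Vs i : Finset α) : Set α))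
    (F : List α → α) : Prop :=
  (∀ (x : List α) (i : Fin P.k), x ≠ [] →
      ∀ h : ∀ a ∈ x, a ∈ ((P.Vs i : Finset α) : Set α),
      F x = ↑(Fi i (x.pmap (fun a ha => ⟨a, ha⟩) h))) ∧
  (∀ x : List α, (¬ ∃ i : Fin P.k, x ≠ [] ∧ ∀ a ∈ x, a ∈ P.Vs i) →
      F x ∈ PO G x ∧ F x ∈ P.Z ∧ ∀ w ∈ P.Z, w ∈ PO G x → P.ord (F x) ≤ P.ord w)

/-- The number of ballots in the profile `x` that vote for the location `v`. -/
def voteCount {β : Type} (x : List β) (v : β) : ℕ :=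
  (x.map (fun w => if w = v then 1 else 0)).sum

namespace ZVPartition

variable {α : Type} {G : SimpleGraph α} (P : ZVPartition G)

theorem eq_root_of_mem_Z {i : Fin P.k} {v : α} (hv : v ∈ P.Vs i) (hZ : v ∈ P.Z) :
    v = P.root i := by
  refine P.root_unique i v hv fun w _ => ?_
  have h : distToSet G v P.Z ≤ 0 := Nat.sInf_le ⟨v, hZ, by simp⟩
  exact h.trans (Nat.zero_le _)

theorem eq_of_mem_of_mem {i j : Fin P.k} {v : α} (hi : v ∈ P.Vs i) (hj : v ∈ P.Vs j) :
    i = j := by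
  by_contra h
  exact Finset.disjoint_left.mp (P.Vs_disjoint i j h) hi hj

theorem mem_Z_of_notMem {v : α} (h : ¬ ∃ i, v ∈ P.Vs i) : v ∈ P.Z :=
  (P.cover v).resolve_right h

/-- Shortest paths leaving `Vᵢ` pass through its root. -/
theorem dist_eq_add {i : Fin P.k} {u v : α} (hu : u ∈ P.Vs i) (hv : v ∉ P.Vs i) :
    G.dist u v = G.dist u (P.root i) + G.dist (P.root i) v := by
  refine le_antisymm (P.hconn.dist_triangle) ?_
  obtain ⟨p, hp⟩ := P.hconn.exists_walk_length_eq_dist u v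
  have hr := (P.separation i u hu v hv p).1
  rw [← hp, ← p.take_spec hr, SimpleGraph.Walk.length_append]
  exact Nat.add_le_add (SimpleGraph.dist_le _) (SimpleGraph.dist_le _)

theorem dist_eq_add' {i : Fin P.k} {u v : α} (hu : u ∉ P.Vs i) (hv : v ∈ P.Vs i) :
    G.dist u v = G.dist u (P.root i) + G.dist (P.root i) v := by
  rw [G.dist_comm, P.dist_eq_add hv hu, G.dist_comm (u := v), G.dist_comm (v := u), add_comm]

/-- The projection of the graph onto `Z` sending every vertex of `Vᵢ` to the root of `Vᵢ`. -/
def proj (v : α) : α :=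
  if h : ∃ i, v ∈ P.Vs i then P.root h.choose else v

theorem proj_of_mem {i : Fin P.k} {v : α} (hv : v ∈ P.Vs i) : P.proj v = P.root i := by
  have h : ∃ i, v ∈ P.Vs i := ⟨i, hv⟩
  rw [proj, dif_pos h, P.eq_of_mem_of_mem h.choose_spec hv]

theorem proj_of_notMem {v : α} (h : ¬ ∃ i, v ∈ P.Vs i) : P.proj v = v := by
  rw [proj, dif_neg h]

theorem proj_of_mem_Z {v : α} (hv : v ∈ P.Z) : P.proj v = v := by
  by_cases h : ∃ i, v ∈ P.Vs i
  · obtain ⟨i, hi⟩ := h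
    rw [P.proj_of_mem hi, ← P.eq_root_of_mem_Z hi hv]
  · exact P.proj_of_notMem h

theorem proj_mem_Z (hroot : ∀ i, P.root i ∈ P.Z) (v : α) : P.proj v ∈ P.Z := by
  by_cases h : ∃ i, v ∈ P.Vs i
  · obtain ⟨i, hi⟩ := h
    rw [P.proj_of_mem hi]
    exact hroot i
  · rw [P.proj_of_notMem h]
    exact P.mem_Z_of_notMem h

theorem proj_mem_Vs {i : Fin P.k} {v : α} : P.proj v ∈ P.Vs i ↔ v ∈ P.Vs i := by
  by_cases h : ∃ j, v ∈ P.Vs j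
  · obtain ⟨j, hj⟩ := h
    rw [P.proj_of_mem hj]
    constructor
    · intro hr
      rwa [P.eq_of_mem_of_mem hr (P.root_mem j)]
    · intro hv
      rw [P.eq_of_mem_of_mem hj hv]
      exact P.root_mem i
  · rw [P.proj_of_notMem h]

theorem dist_proj {z : α} (v : α) (hz : z ∈ P.Z) :
    G.dist v z = G.dist v (P.proj v) + G.dist (P.proj v) z := by
  by_cases h : ∃ i, v ∈ P.Vs i
  · obtain ⟨i, hi⟩ := h
    rw [P.proj_of_mem hi]
    by_cases hzi : z ∈ P.Vs i
    · rw [P.eq_root_of_mem_Z hzi hz]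
      simp
    · exact P.dist_eq_add hi hzi
  · rw [P.proj_of_notMem h]
    simp

theorem wPref_proj {a b : α} (v : α) (ha : a ∈ P.Z) (hb : b ∈ P.Z) :
    wPref G (P.proj v) a b ↔ wPref G v a b := by
  unfold wPref
  rw [P.dist_proj v ha, P.dist_proj v hb]
  omega

theorem sPref_proj {a b : α} (v : α) (ha : a ∈ P.Z) (hb : b ∈ P.Z) :
    sPref G (P.proj v) a b ↔ sPref G v a b := by
  unfold sPref
  rw [P.dist_proj v ha, P.dist_proj v hb]
  omega

theorem dominates_map_proj {a b : α} (x : List α) (ha : a ∈ P.Z) (hb : b ∈ P.Z) :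
    Dominates G (x.map P.proj) a b ↔ Dominates G x a b := by
  simp [Dominates, P.wPref_proj _ ha hb, P.sPref_proj _ ha hb]

/-- All ballots of the nonempty profile `x` lie in a common `Vᵢ`. -/
def Monopolized (x : List α) : Prop :=
  ∃ i : Fin P.k, x ≠ [] ∧ ∀ a ∈ x, a ∈ P.Vs i

theorem monopolized_map_proj {x : List α} :
    P.Monopolized (x.map P.proj) ↔ P.Monopolized x := by
  simp [Monopolized, P.proj_mem_Vs]

/-- An agent weakly preferring a non-root vertex of `Vᵢ` to some `u ∉ Vᵢ` strictly prefers
the root of `Vᵢ` to `u`. -/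
theorem sPref_root {i : Fin P.k} {u v w : α} (hu : u ∉ P.Vs i) (hw : w ∈ P.Vs i)
    (hwr : w ≠ P.root i) (h : wPref G v w u) : sPref G v (P.root i) u := by
  unfold wPref at h
  unfold sPref
  by_cases hv : v ∈ P.Vs i
  · have := P.dist_eq_add hv hu
    have := P.hconn.pos_dist_of_ne (u := P.root i) (v := u) (fun h => hu (h ▸ P.root_mem i))
    omega
  · have := P.dist_eq_add' hv hw
    have := P.hconn.pos_dist_of_ne hwr.symm
    omega

theorem not_wPref_root {i : Fin P.k} {v w : α} (hv : v ∉ P.Vs i) (hw : w ∈ P.Vs i)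
    (hwr : w ≠ P.root i) : ¬ wPref G v w (P.root i) := by
  unfold wPref
  have := P.dist_eq_add' hv hw
  have := P.hconn.pos_dist_of_ne hwr.symm
  omega

/-- Unless all ballots lie in a common `Vᵢ`, Pareto optimality of a vertex of `Z` may be tested
against vertices of `Z` only. -/
theorem mem_PO_iff (hroot : ∀ i, P.root i ∈ P.Z) {x : List α} (hx : ¬ P.Monopolized x) {u : α}
    (hu : u ∈ P.Z) : u ∈ PO G x ↔ ∀ w ∈ P.Z, ¬ Dominates G x w u := by
  constructor
  · exact fun h w _ hw => h ⟨w, hw⟩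
  · rintro h ⟨w, hw⟩
    by_cases hwZ : w ∈ P.Z
    · exact h w hwZ hw
    obtain ⟨i, hi⟩ := (P.cover w).resolve_left hwZ
    have hwr : w ≠ P.root i := fun e => hwZ (e ▸ hroot i)
    obtain ⟨a, ha, -⟩ := hw.2
    have hout : ∃ b ∈ x, b ∉ P.Vs i := by
      by_contra! hc
      exact hx ⟨i, List.ne_nil_of_mem ha, hc⟩
    obtain ⟨b, hb, hbi⟩ := hout
    by_cases hui : u ∈ P.Vs i
    · obtain rfl := P.eq_root_of_mem_Z hui hu
      exact P.not_wPref_root hbi hi hwr (hw.1 b hb)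
    · have hs : ∀ c ∈ x, sPref G c (P.root i) u :=
        fun c hc => P.sPref_root hui hi hwr (hw.1 c hc)
      exact h _ (hroot i) ⟨fun c hc => (hs c hc).le, b, hb, hs b hb⟩

theorem mem_PO_map_proj (hroot : ∀ i, P.root i ∈ P.Z) {x : List α} (hx : ¬ P.Monopolized x)
    {u : α} (hu : u ∈ P.Z) : u ∈ PO G (x.map P.proj) ↔ u ∈ PO G x := by
  rw [P.mem_PO_iff hroot hx hu, P.mem_PO_iff hroot (P.monopolized_map_proj.not.mpr hx) hu]
  exact forall₂_congr fun w hw => not_congr (P.dominates_map_proj x hw hu)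

/-- The retraction of the graph onto `Vᵢ` sending every other vertex to the root of `Vᵢ`. -/
def retract (i : Fin P.k) (v : α) : ((P.Vs i : Finset α) : Set α) :=
  if h : v ∈ P.Vs i then ⟨v, h⟩ else ⟨P.root i, P.root_mem i⟩

theorem retract_of_mem {i : Fin P.k} {v : α} (h : v ∈ P.Vs i) : P.retract i v = ⟨v, h⟩ :=
  dif_pos h

theorem retract_of_notMem {i : Fin P.k} {v : α} (h : v ∉ P.Vs i) :
    P.retract i v = ⟨P.root i, P.root_mem i⟩ :=
  dif_neg h

theorem eq_root_of_adj {i : Fin P.k} {u v : α} (hu : u ∈ P.Vs i) (hv : v ∉ P.Vs i)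
    (h : G.Adj u v) : u = P.root i := by
  have hs := (P.separation i u hu v hv h.toWalk).1
  have hne : P.root i ≠ v := fun e => hv (e ▸ P.root_mem i)
  simp [hne] at hs
  exact hs.symm

theorem retract_eq_or_adj (i : Fin P.k) {u v : α} (h : G.Adj u v) :
    P.retract i u = P.retract i v ∨
      (G.induce ((P.Vs i : Finset α) : Set α)).Adj (P.retract i u) (P.retract i v) := by
  by_cases hu : u ∈ P.Vs i <;> by_cases hv : v ∈ P.Vs i
  · right
    rw [P.retract_of_mem hu, P.retract_of_mem hv]
    exact h
  · left
    rw [P.retract_of_mem hu, P.retract_of_notMem hv]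
    exact Subtype.ext (P.eq_root_of_adj hu hv h)
  · left
    rw [P.retract_of_notMem hu, P.retract_of_mem hv]
    exact Subtype.ext (P.eq_root_of_adj hv hu h.symm).symm
  · left
    rw [P.retract_of_notMem hu, P.retract_of_notMem hv]

theorem exists_retract_walk (i : Fin P.k) {u v : α} (p : G.Walk u v) :
    ∃ q : (G.induce ((P.Vs i : Finset α) : Set α)).Walk (P.retract i u) (P.retract i v),
      q.length ≤ p.length := by
  induction p with
  | nil => exact ⟨.nil, le_rfl⟩
  | cons h p ih =>
    obtain ⟨q, hq⟩ := ih
    rcases P.retract_eq_or_adj i h with e | hadj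
    · exact ⟨q.copy e.symm rfl, by simp; omega⟩
    · exact ⟨.cons hadj q, by simpa using hq⟩

/-- Each `Vᵢ` is isometrically embedded. -/
theorem dist_induce {i : Fin P.k} (u v : ((P.Vs i : Finset α) : Set α)) :
    (G.induce ((P.Vs i : Finset α) : Set α)).dist u v = G.dist (u : α) v := by
  obtain ⟨p, hp⟩ := P.hconn.exists_walk_length_eq_dist (u : α) v
  obtain ⟨q, hq⟩ := P.exists_retract_walk i p
  have hu : P.retract i u = u := P.retract_of_mem u.2
  have hv : P.retract i v = v := P.retract_of_mem v.2
  have hq' := SimpleGraph.dist_le (q.copy hu hv)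
  rw [SimpleGraph.Walk.length_copy] at hq'
  refine le_antisymm (by omega) ?_
  obtain ⟨r, hr⟩ := (q.copy hu hv).reachable.exists_walk_length_eq_dist
  rw [← hr]
  have := SimpleGraph.dist_le (r.map (SimpleGraph.Embedding.induce (G := G) _).toHom)
  rwa [SimpleGraph.Walk.length_map] at this

end ZVPartition

theorem map_profileMinus {α β : Type} {n : ℕ} (f : α → β) (x : Fin n → α) (C : Finset (Fin n)) :
    (profileMinus x C).map f = profileMinus (fun j => f (x j)) C := by
  simp [profileMinus, Function.comp_def]

theorem length_profileMinus_le {α : Type} {n : ℕ} (x : Fin n → α) (C : Finset (Fin n)) :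
    (profileMinus x C).length ≤ n := by
  rw [profileMinus, List.length_map]
  exact (List.length_filter_le _ _).trans (by simp)

theorem mem_profileMinus {α : Type} {n : ℕ} {x : Fin n → α} {C : Finset (Fin n)} {j : Fin n}
    (hj : j ∉ C) : x j ∈ profileMinus x C :=
  List.mem_map.mpr ⟨j, by simp [hj], rfl⟩

theorem voteCount_eq_count {β : Type} (x : List β) (v : β) : voteCount x v = x.count v := by
  induction x with
  | nil => rfl
  | cons a x ih =>
    have ih' : (x.map (fun w => if w = v then 1 else 0)).sum = x.count v := ih
    simp only [voteCount, List.map_cons, List.sum_cons, ih', List.count_cons, beq_iff_eq]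
    omega

/-- An anonymous mechanism returning `r` on profiles with arbitrarily many votes for every
location returns `r` on some extension of any given profile. -/
theorem Anonymous.exists_append_eq {β : Type} {F : List β → β} (hF : Anonymous F) {r : β}
    (hr : {τ : ℕ | ∃ x : List β, (∀ v, τ ≤ voteCount x v) ∧ F x = r}.Infinite) (y : List β) :
    ∃ A : List β, F (A ++ y) = r := by
  obtain ⟨τ, ⟨x, hx, hxr⟩, hτ⟩ := hr.exists_gt y.length
  refine ⟨x.diff y, ?_⟩
  rw [← hxr]
  refine hF _ _ (List.perm_append_comm.trans
    (List.subperm_append_diff_self_of_count_le fun v _ => ?_))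
  rw [← voteCount_eq_count x]
  exact List.count_le_length.trans (hτ.le.trans (hx v))

namespace IsFStar

variable {α : Type} {G : SimpleGraph α} {P : ZVPartition G}
  {Fi : ∀ i : Fin P.k, List ((P.Vs i : Finset α) : Set α) → ((P.Vs i : Finset α) : Set α)}
  {F : List α → α}

theorem apply_map_val (hF : IsFStar G P Fi F) {i : Fin P.k}
    {L : List ((P.Vs i : Finset α) : Set α)} (hL : L ≠ []) :
    F (L.map Subtype.val) = (Fi i L : α) := by
  have hmem : ∀ a ∈ L.map Subtype.val, a ∈ ((P.Vs i : Finset α) : Set α) := by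
    intro a ha
    obtain ⟨b, -, rfl⟩ := List.mem_map.mp ha
    exact b.2
  rw [hF.1 (L.map Subtype.val) i (List.map_eq_nil_iff.not.mpr hL) hmem, List.pmap_map]
  congr 2
  simp

theorem mem_Vs (hF : IsFStar G P Fi F) {i : Fin P.k} {x : List α} (hx : x ≠ [])
    (h : ∀ a ∈ x, a ∈ P.Vs i) : F x ∈ P.Vs i := by
  rw [hF.1 x i hx h]
  exact Subtype.prop _

theorem mem_Z (hF : IsFStar G P Fi F) {x : List α} (hx : ¬ P.Monopolized x) : F x ∈ P.Z :=
  (hF.2 x hx).2.1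

/-- Projecting the ballots does not change the projected outcome. -/
theorem proj_apply_map (hF : IsFStar G P Fi F) (hroot : ∀ i, P.root i ∈ P.Z) (x : List α) :
    P.proj (F (x.map P.proj)) = P.proj (F x) := by
  by_cases hx : P.Monopolized x
  · obtain ⟨i, hne, hi⟩ := hx
    rw [P.proj_of_mem (hF.mem_Vs hne hi), P.proj_of_mem (hF.mem_Vs (i := i) (by simpa using hne)
      (by simpa [P.proj_mem_Vs] using hi))]
  · have hx' := P.monopolized_map_proj.not.mpr hx
    obtain ⟨h1, h2, h3⟩ := hF.2 x hx
    obtain ⟨h1', h2', h3'⟩ := hF.2 _ hx'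
    congr 1
    exact P.ord_inj h2' h2 (le_antisymm (h3' _ h2 ((P.mem_PO_map_proj hroot hx h2).mpr h1))
      (h3 _ h2' ((P.mem_PO_map_proj hroot hx h2').mp h1')))

/-- On profiles over `Z`, the projected outcome is the leftmost Pareto optimal location in `Z`. -/
theorem proj_isLeftmost (hF : IsFStar G P Fi F) (hroot : ∀ i, P.root i ∈ P.Z) {x : List α}
    (hxZ : ∀ a ∈ x, a ∈ P.Z) :
    P.proj (F x) ∈ PO G x ∧ P.proj (F x) ∈ P.Z ∧
      ∀ w ∈ P.Z, w ∈ PO G x → P.ord (P.proj (F x)) ≤ P.ord w := by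
  by_cases hx : P.Monopolized x
  · obtain ⟨i, hne, hi⟩ := hx
    have hall : ∀ a ∈ x, a = P.root i := fun a ha => P.eq_root_of_mem_Z (hi a ha) (hxZ a ha)
    rw [P.proj_of_mem (hF.mem_Vs hne hi)]
    refine ⟨?_, hroot i, fun w _ hw => ?_⟩
    · rintro ⟨u, -, a, ha, hs⟩
      rw [hall a ha] at hs
      simp [sPref] at hs
    · by_cases e : w = P.root i
      · rw [e]
      · refine absurd ⟨P.root i, fun a ha => ?_, ?_⟩ hw
        · simp [hall a ha, wPref]
        · obtain ⟨a, ha⟩ := List.exists_mem_of_ne_nil x hne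
          refine ⟨a, ha, ?_⟩
          have := P.hconn.pos_dist_of_ne (Ne.symm e)
          simpa [hall a ha, sPref] using this
  · rw [P.proj_of_mem_Z (hF.mem_Z hx)]
    exact hF.2 x hx

end IsFStar

/-- Let `G` be a finite connected graph with a ZV-ordered
partition `P`, and for each `i` let `Fi i` be a mechanism on the induced subgraph
`Gᵢ` that is anonymous, Pareto optimal, returns the root `R(Vᵢ)` on profiles
where every location of `Vᵢ` is voted for at least `τ` times (for infinitely many
`τ`), and is group-manipulation-resistant. Suppose further that `R(Vᵢ) ∈ Z` for
all `i`, and that the mechanism `F_Z` defined on profiles over `Z` and returning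
the leftmost Pareto optimal location in `Z` is group-manipulation-resistant
(w.r.t. profiles and ballots over `Z`). Then any mechanism `F*` determined by
this data is group-manipulation-resistant. -/
theorem fstar_gmr_of_roots_in_Z
    {α : Type} [Fintype α] (G : SimpleGraph α) (P : ZVPartition G)
    (Fi : ∀ i : Fin P.k, List ((P.Vs i : Finset α) : Set α) → ((P.Vs i : Finset α) : Set α))
    (hanon : ∀ i, Anonymous (Fi i))
    (hpo : ∀ i, ParetoOptimal (G.induce ((P.Vs i : Finset α) : Set α)) (Fi i))
    (hτ : ∀ i, {τ : ℕ | ∃ x : List ((P.Vs i : Finset α) : Set α),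
        (∀ v : ((P.Vs i : Finset α) : Set α), τ ≤ voteCount x v) ∧
        Fi i x = ⟨P.root i, Finset.mem_coe.mpr (P.root_mem i)⟩}.Infinite)
    (hgmr : ∀ i, GMR (G.induce ((P.Vs i : Finset α) : Set α)) (Fi i))
    (hrootZ : ∀ i : Fin P.k, P.root i ∈ P.Z)
    (hFZ : ∀ FZ : List α → α,
        (∀ x : List α, (∀ a ∈ x, a ∈ P.Z) →
            FZ x ∈ PO G x ∧ FZ x ∈ P.Z ∧ ∀ w ∈ P.Z, w ∈ PO G x → P.ord (FZ x) ≤ P.ord w) →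
        GMRon G (P.Z : Set α) FZ) :
    ∀ F : List α → α, IsFStar G P Fi F → GMR G F := by
  intro F hF
  rintro ⟨n, x, C, A, hw, j, hjC, hs⟩
  have hZ := hFZ (fun y => P.proj (F y)) fun y hy => hF.proj_isLeftmost hrootZ hy
  -- Coalitions cannot improve the projected outcome.
  have hproj : (∀ i ∈ C, wPref G (x i) (P.proj (F (A ++ profileMinus x C)))
      (P.proj (F (List.ofFn x)))) → (∃ i ∈ C, sPref G (x i)
      (P.proj (F (A ++ profileMinus x C))) (P.proj (F (List.ofFn x)))) → False := by
    intro h1 h2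
    refine hZ ⟨n, fun i => P.proj (x i), C, A.map P.proj, fun i => P.proj_mem_Z hrootZ _, ?_, ?_⟩
    · intro a ha
      obtain ⟨b, -, rfl⟩ := List.mem_map.mp ha
      exact P.proj_mem_Z hrootZ b
    · have e1 : P.proj (F (List.ofFn fun i => P.proj (x i))) = P.proj (F (List.ofFn x)) := by
        rw [← hF.proj_apply_map hrootZ (List.ofFn x), List.map_ofFn]
        rfl
      have e2 : P.proj (F (A.map P.proj ++ profileMinus (fun i => P.proj (x i)) C)) =
          P.proj (F (A ++ profileMinus x C)) := by
        rw [← map_profileMinus, ← List.map_append, hF.proj_apply_map hrootZ]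
      simp only [e1, e2, P.wPref_proj _ (P.proj_mem_Z hrootZ _) (P.proj_mem_Z hrootZ _),
        P.sPref_proj _ (P.proj_mem_Z hrootZ _) (P.proj_mem_Z hrootZ _)]
      exact ⟨h1, h2⟩
  have hne : List.ofFn x ≠ [] := List.ne_nil_of_mem (List.mem_ofFn.mpr ⟨j, rfl⟩)
  by_cases hx : P.Monopolized (List.ofFn x)
  · obtain ⟨i, -, hi⟩ := hx
    have hxi : ∀ l, x l ∈ P.Vs i := fun l => hi _ (List.mem_ofFn.mpr ⟨l, rfl⟩)
    lift x to Fin n → ((P.Vs i : Finset α) : Set α) using hxi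
    have ex : F (List.ofFn fun l => (x l : α)) = (Fi i (List.ofFn x) : α) := by
      rw [← hF.apply_map_val (by simpa using hne), List.map_ofFn]
      rfl
    rw [ex] at hw hs
    by_cases hy : A ++ profileMinus (fun l => (x l : α)) C ≠ [] ∧ ∀ a ∈ A, a ∈ P.Vs i
    · obtain ⟨hyne, hA⟩ := hy
      lift A to List ((P.Vs i : Finset α) : Set α) using hA
      rw [← map_profileMinus Subtype.val, ← List.map_append] at hw hs hyne
      rw [hF.apply_map_val (List.map_eq_nil_iff.not.mp hyne)] at hw hs
      refine hgmr i ⟨n, x, C, A, fun l hl => ?_, j, hjC, ?_⟩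
      · simpa only [wPref, P.dist_induce] using hw l hl
      · simpa only [sPref, P.dist_induce] using hs
    · -- The outcome after the manipulation is the root of `Vᵢ` or lies outside `Vᵢ`.
      have hroot : ∀ l, G.dist (x l : α) (P.root i) ≤
          G.dist (x l : α) (F (A ++ profileMinus (fun l => (x l : α)) C)) := by
        intro l
        by_cases hb : F (A ++ profileMinus (fun l => (x l : α)) C) ∈ P.Vs i
        · have hm : ¬ P.Monopolized (A ++ profileMinus (fun l => (x l : α)) C) := by
            rintro ⟨m, hmne, hm⟩
            obtain rfl := P.eq_of_mem_of_mem (hF.mem_Vs hmne hm) hb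
            exact hy ⟨hmne, fun a ha => hm a (List.mem_append_left _ ha)⟩
          rw [P.eq_root_of_mem_Z hb (hF.mem_Z hm)]
        · rw [P.dist_eq_add (x l).2 hb]
          exact Nat.le_add_right _ _
      obtain ⟨B, hB⟩ := (hanon i).exists_append_eq (hτ i) (profileMinus x C)
      refine hgmr i ⟨n, x, C, B, fun l hl => ?_, j, hjC, ?_⟩
      · simp only [wPref, P.dist_induce, hB]
        exact (hroot l).trans (hw l hl)
      · simp only [sPref, P.dist_induce, hB]
        exact (hroot j).trans_lt hs
  · have ha := hF.mem_Z hx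
    by_cases hb : F (A ++ profileMinus x C) ∈ P.Z
    · rw [P.proj_of_mem_Z ha, P.proj_of_mem_Z hb] at hproj
      exact hproj hw ⟨j, hjC, hs⟩
    · have hy : P.Monopolized (A ++ profileMinus x C) := by
        by_contra h
        exact hb (hF.mem_Z h)
      obtain ⟨i, hyne, hi⟩ := hy
      have hbi := hF.mem_Vs hyne hi
      have hbr : F (A ++ profileMinus x C) ≠ P.root i := fun e => hb (e ▸ hrootZ i)
      rw [P.proj_of_mem_Z ha, P.proj_of_mem hbi] at hproj
      by_cases hai : F (List.ofFn x) ∈ P.Vs i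
      · rw [P.eq_root_of_mem_Z hai ha] at hw
        refine hx ⟨i, hne, fun a hax => ?_⟩
        obtain ⟨l, rfl⟩ := List.mem_ofFn.mp hax
        by_contra hl
        refine P.not_wPref_root hl hbi hbr (hw l ?_)
        by_contra hlC
        exact hl (hi _ (List.mem_append_right _ (mem_profileMinus hlC)))
      · have hr : ∀ l ∈ C, sPref G (x l) (P.root i) (F (List.ofFn x)) :=
          fun l hl => P.sPref_root hai hbi hbr (hw l hl)
        exact hproj (fun l hl => (hr l hl).le) ⟨j, hjC, hr j hjC⟩
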